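/- Let K be a field of characteristic zero, let d, D, n be positive integers, and let α = (α_2, ..., α_n) ∈ K^{n−1}. Consider the system x_1' = x_1^d + (x_2+1)^d + ⋯ + (x_n+1)^d, x_i' = α_i x_i^D for 2 ≤ i ≤ n, with Lie derivative 𝓛_{g_α} = (x_1^d + Σ_{j=2}^n (x_j+1)^d) ∂/∂x_1 + Σ_{i=2}^{n} α_i x_i^D ∂/∂x_i, and set p_{α,i} := x_1^{(i)} − 𝓛_{g_α}^{i−1}( x_1^d + (x_2+1)^d + ⋯ + (x_n+1)^d ) for 1 ≤ i ≤ n. For 0 ≤ ℓ ≤ n, let F_ℓ := K(x_1, ..., x_1^{(ℓ−1)}, x_1^{(ℓ+1)}, ..., x_1^{(n)}) be the field of rational functions in the variables x_1^{(i)} with 0 ≤ i ≤ n and i ≠ ℓ. Then for every 0 ≤ ℓ ≤ n, the ideal generated by p_{α,1}, ..., p_{α,n} in F_ℓ[x_1^{(ℓ)}, x_2, ..., x_n] is radical. -/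

import Mathlib

open MvPolynomial

noncomputable section

/-- The right-hand side of the system `(3)`:
`g_1 = x_1^d + (x_2+1)^d + ⋯ + (x_n+1)^d`, `g_i = α_i x_i^D` for `i ≠ 1`. -/
def gsys (K : Type*) [CommRing K] (n d D : ℕ) [NeZero n]
    (α : {i : Fin n // i ≠ 0} → K) : Fin n → MvPolynomial (Fin n) K := fun i =>
  if h : i = 0 then
    X 0 ^ d + ∑ j ∈ Finset.univ.filter (fun j : Fin n => j ≠ 0), (X j + 1) ^ d
  else C (α ⟨i, h⟩) * X i ^ D

/-- The Lie derivative `𝓛_g = Σ_{i=1}^n g_i ∂/∂x_i` on `K[x_1, …, x_n]`. -/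
def lieD {K : Type*} [CommRing K] {n : ℕ} (g : Fin n → MvPolynomial (Fin n) K) :
    Derivation K (MvPolynomial (Fin n) K) (MvPolynomial (Fin n) K) :=
  MvPolynomial.mkDerivation K g

/-- The polynomials `p_{α,i} = x_1^{(i)} - 𝓛_{g_α}^{i-1}(g_{α,1})`, `1 ≤ i ≤ n`
(indexed here by `j : Fin n` with `i = j + 1`), as elements of the polynomial ring
in the variables `x_1, x_1', …, x_1^{(n)}` (the `Sum.inl` variables) and
`x_2, …, x_n` (the `Sum.inr` variables). -/
def pSys (K : Type*) [CommRing K] (n d D : ℕ) [NeZero n]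
    (α : {i : Fin n // i ≠ 0} → K) :
    Fin n → MvPolynomial (Fin (n + 1) ⊕ {i : Fin n // i ≠ 0}) K := fun j =>
  X (Sum.inl j.succ) -
    rename (fun i : Fin n => if h : i = 0 then Sum.inl 0 else Sum.inr ⟨i, h⟩)
      ((⇑(lieD (gsys K n d D α)))^[(j : ℕ)] (gsys K n d D α 0))

/-- An ideal killed by a map to a reduced ring is radical if the map has a section modulo
the ideal. -/
theorem Ideal.isRadical_of_retraction {A B : Type*} [CommRing A] [CommRing B] [IsReduced B]
    (θ : A →+* B) (s : B →+* A) (I : Ideal A) (hI : I ≤ RingHom.ker θ)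
    (hs : ∀ a, a - s (θ a) ∈ I) : I.IsRadical := by
  rintro a ⟨m, hm⟩
  have h : θ a = 0 := by
    have := hI hm
    rw [RingHom.mem_ker, map_pow] at this
    exact eq_zero_of_pow_eq_zero this
  simpa [h] using hs a

/-- The ideal generated by the polynomials `y_{j+1} - f_j(y_0, x)` is radical, since it is the
kernel of a retraction onto a polynomial ring. -/
theorem isRadical_span_graph {K : Type*} [Field K] (n : ℕ) [NeZero n]
    (f : Fin n → MvPolynomial (Fin n) K) :
    (Ideal.span (Set.range fun j : Fin n =>
      (X (Sum.inl j.succ) -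
        rename (fun i : Fin n => if h : i = 0 then Sum.inl 0 else Sum.inr ⟨i, h⟩) (f j) :
        MvPolynomial (Fin (n + 1) ⊕ {i : Fin n // i ≠ 0}) K))).IsRadical := by
  set ι : Fin n → Fin (n + 1) ⊕ {i : Fin n // i ≠ 0} :=
    fun i => if h : i = 0 then Sum.inl 0 else Sum.inr ⟨i, h⟩ with hι
  set I := Ideal.span (Set.range fun j : Fin n =>
    (X (Sum.inl j.succ) - rename ι (f j) :
      MvPolynomial (Fin (n + 1) ⊕ {i : Fin n // i ≠ 0}) K)) with hIdef
  let v : Fin (n + 1) ⊕ {i : Fin n // i ≠ 0} → MvPolynomial (Fin n) K :=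
    Sum.elim (Fin.cases (X 0) f) (fun i => X i.1)
  let θ : MvPolynomial (Fin (n + 1) ⊕ {i : Fin n // i ≠ 0}) K →ₐ[K] MvPolynomial (Fin n) K :=
    aeval v
  have hθ : ∀ p, θ (rename ι p) = p := by
    intro p
    have hv : v ∘ ι = X := by
      funext i
      by_cases h : i = 0
      · simp [hι, v, h]
      · simp [hι, v, h]
    simp only [θ, aeval_rename, hv, aeval_X_left_apply]
  refine Ideal.isRadical_of_retraction θ.toRingHom (rename ι : _ →ₐ[K] _).toRingHom I ?_ ?_
  · rw [hIdef, Ideal.span_le]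
    rintro _ ⟨j, rfl⟩
    change θ (X (Sum.inl j.succ) - rename ι (f j)) = 0
    rw [map_sub, hθ]
    simp [θ, v]
  · intro a
    rw [← Ideal.Quotient.eq]
    have key : (Ideal.Quotient.mkₐ K I) =
        ((Ideal.Quotient.mkₐ K I).comp (rename ι)).comp θ := by
      apply MvPolynomial.algHom_ext
      rintro (i | i)
      · refine Fin.cases ?_ (fun j => ?_) i
        · simp [θ, v, hι]
        · have : (X (Sum.inl j.succ) - rename ι (f j)) ∈ I := Ideal.subset_span ⟨j, rfl⟩
          simpa [θ, v] using Ideal.Quotient.eq.2 this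
      · simp [θ, v, hι, i.2]
    exact DFunLike.congr_fun key a

/-- Splitting off the index `ℓ`, with the other indices moved to the right summand. -/
def splitIndexEquiv {ι : Type*} [DecidableEq ι] (ℓ : ι) (τ : Type*) :
    ι ⊕ τ ≃ (Unit ⊕ τ) ⊕ {i : ι // i ≠ ℓ} where
  toFun := Sum.elim
    (fun i => if h : i = ℓ then Sum.inl (Sum.inl ()) else Sum.inr ⟨i, h⟩)
    (fun t => Sum.inl (Sum.inr t))
  invFun := Sum.elim (Sum.elim (fun _ => Sum.inl ℓ) Sum.inr) (fun i => Sum.inl i.1)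
  left_inv := by
    rintro (i | t)
    · by_cases h : i = ℓ <;> simp [h]
    · simp
  right_inv := by
    rintro ((u | t) | i)
    · simp
    · simp
    · simp [i.2]

theorem statement14 (K : Type*) [Field K] [CharZero K] (n d D : ℕ) [NeZero n]
    (hd : 0 < d) (hD : 0 < D)
    (α : {i : Fin n // i ≠ 0} → K) (ℓ : Fin (n + 1)) :
    (Ideal.span (Set.range fun j : Fin n =>
      eval₂Hom
        ((C : FractionRing (MvPolynomial {i : Fin (n + 1) // i ≠ ℓ} K) →+*
            MvPolynomial (Unit ⊕ {i : Fin n // i ≠ 0})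
              (FractionRing (MvPolynomial {i : Fin (n + 1) // i ≠ ℓ} K))).comp
          ((algebraMap (MvPolynomial {i : Fin (n + 1) // i ≠ ℓ} K)
              (FractionRing (MvPolynomial {i : Fin (n + 1) // i ≠ ℓ} K))).comp
            (C : K →+* MvPolynomial {i : Fin (n + 1) // i ≠ ℓ} K)))
        (Sum.elim
          (fun i : Fin (n + 1) =>
            if h : i = ℓ then X (Sum.inl ())
            else C (algebraMap (MvPolynomial {i : Fin (n + 1) // i ≠ ℓ} K)
              (FractionRing (MvPolynomial {i : Fin (n + 1) // i ≠ ℓ} K)) (X ⟨i, h⟩)))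
          (fun i : {i : Fin n // i ≠ 0} => X (Sum.inr i)))
        (pSys K n d D α j))).IsRadical := by
  classical
  let S := MvPolynomial {i : Fin (n + 1) // i ≠ ℓ} K
  let F := FractionRing S
  let τ := {i : Fin n // i ≠ 0}
  let e : MvPolynomial (Fin (n + 1) ⊕ τ) K ≃ₐ[K] MvPolynomial (Unit ⊕ τ) S :=
    (renameEquiv K (splitIndexEquiv ℓ τ)).trans (sumAlgEquiv K _ _)
  have hrad := isRadical_span_graph n
    (fun j : Fin n => (⇑(lieD (gsys K n d D α)))^[(j : ℕ)] (gsys K n d D α 0))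
  set I := Ideal.span (Set.range (pSys K n d D α)) with hI
  replace hrad : I.IsRadical := hrad
  have h1 : (I.map e.toRingEquiv.toRingHom).IsRadical := by
    rw [← hrad.radical, Ideal.map_radical_of_surjective e.surjective]
    · exact Ideal.radical_isRadical _
    · intro a ha
      have : a = 0 := e.injective ((RingHom.mem_ker.1 ha).trans (map_zero e).symm)
      exact this ▸ I.zero_mem
  let : Algebra (MvPolynomial (Unit ⊕ τ) S) (MvPolynomial (Unit ⊕ τ) F) :=
    algebraMvPolynomial
  have h2 : ((I.map e.toRingEquiv.toRingHom).map
      (algebraMap (MvPolynomial (Unit ⊕ τ) S) (MvPolynomial (Unit ⊕ τ) F))).IsRadical := by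
    rw [← h1.radical, IsLocalization.map_radical ((nonZeroDivisors S).map C)]
    exact Ideal.radical_isRadical _
  rw [Ideal.map_map, hI, Ideal.map_span, ← Set.range_comp] at h2
  refine (congrArg (fun s => (Ideal.span s).IsRadical)
    (congrArg Set.range (funext fun j => ?_))).mpr h2
  refine DFunLike.congr_fun ?_ (pSys K n d D α j)
  have he : ∀ p, e p = sumAlgEquiv K (Unit ⊕ τ) {i : Fin (n + 1) // i ≠ ℓ}
      (rename (splitIndexEquiv ℓ τ) p) := fun _ => rfl
  apply MvPolynomial.ringHom_ext
  · intro a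
    simp [-ne_eq, he]
    rfl
  · rintro (i | i)
    · by_cases h : i = ℓ
      · simp [-ne_eq, he, h, splitIndexEquiv]
      · simp [-ne_eq, he, h, splitIndexEquiv]
        rfl
    · simp [-ne_eq, he, splitIndexEquiv]
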